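/- Let I be a finite set and 𝒜𝒫(I) the lattice of partitions of I ordered by refinement. For a partition α let ⟨α⟩ denote its skeleton, the multiset of cardinalities of its blocks, and let α ∼ β denote the equivalence ⟨α⟩ = ⟨β⟩. Then the zeta and Möbius matrices of the partition lattice are compatible with ∼: for all partitions α, β with ⟨α⟩ = ⟨β⟩ and every partition δ, (1) |{γ ∈ 𝒜𝒫(I) : ⟨γ⟩ = ⟨δ⟩ and α ⪯ γ}| = |{γ : ⟨γ⟩ = ⟨δ⟩ and β ⪯ γ}|, and (2) ∑_{γ : ⟨γ⟩=⟨δ⟩, γ ⪯ α} μ(γ,α) = ∑_{γ : ⟨γ⟩=⟨δ⟩, γ ⪯ β} μ(γ,β), where μ is the Möbius function of the partition lattice; the same compatibility holds for the transpose zeta and Möbius matrices. -/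

import Mathlib

open Finset

namespace PSC

/-- The order isomorphism of finsets induced by a permutation. -/
def finsetIso {I : Type*} (σ : I ≃ I) : Finset I ≃o Finset I where
  toEquiv := σ.finsetCongr
  map_rel_iff' := by
    intro a b
    simp [Equiv.finsetCongr_apply]

/-- Transport of a partition along a permutation. -/
def pmap {I : Type*} [Fintype I] [DecidableEq I] (σ : I ≃ I)
    (P : Finpartition (Finset.univ : Finset I)) : Finpartition (Finset.univ : Finset I) :=
  (P.map (finsetIso σ)).copy (by simp [finsetIso])

theorem pmap_parts {I : Type*} [Fintype I] [DecidableEq I] (σ : I ≃ I)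
    (P : Finpartition (Finset.univ : Finset I)) :
    (pmap σ P).parts = P.parts.map (Finset.mapEmbedding σ.toEmbedding).toEmbedding := by
  ext x
  change x ∈ P.parts.map _ ↔ _
  simp only [Finset.mem_map]
  rfl

theorem mem_pmap {I : Type*} [Fintype I] [DecidableEq I] (σ : I ≃ I)
    (P : Finpartition (Finset.univ : Finset I)) (A : Finset I) :
    A ∈ (pmap σ P).parts ↔ ∃ B ∈ P.parts, B.map σ.toEmbedding = A := by
  simp [pmap_parts]

theorem skel_pmap {I : Type*} [Fintype I] [DecidableEq I] (σ : I ≃ I)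
    (P : Finpartition (Finset.univ : Finset I)) :
    (pmap σ P).parts.val.map Finset.card = P.parts.val.map Finset.card := by
  rw [pmap_parts]
  simp [Finset.map_val, Multiset.map_map, Function.comp_def]

theorem pmap_symm {I : Type*} [Fintype I] [DecidableEq I] (σ : I ≃ I)
    (P : Finpartition (Finset.univ : Finset I)) : pmap σ.symm (pmap σ P) = P := by
  ext A
  simp [mem_pmap, Finset.map_map]

theorem pmap_mono {I : Type*} [Fintype I] [DecidableEq I] (σ : I ≃ I)
    {P Q : Finpartition (Finset.univ : Finset I)} (h : P ≤ Q) : pmap σ P ≤ pmap σ Q := by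
  intro A hA
  obtain ⟨B, hB, rfl⟩ := (mem_pmap _ _ _).1 hA
  obtain ⟨C, hC, hBC⟩ := h hB
  exact ⟨_, (mem_pmap _ _ _).2 ⟨C, hC, rfl⟩, Finset.map_subset_map.2 hBC⟩

/-- Transport of partitions as an equivalence. -/
def pequiv {I : Type*} [Fintype I] [DecidableEq I] (σ : I ≃ I) :
    Finpartition (Finset.univ : Finset I) ≃ Finpartition (Finset.univ : Finset I) where
  toFun := pmap σ
  invFun := pmap σ.symm
  left_inv := pmap_symm σ
  right_inv := pmap_symm σ.symm

theorem pequiv_le {I : Type*} [Fintype I] [DecidableEq I] (σ : I ≃ I)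
    (P Q : Finpartition (Finset.univ : Finset I)) : pequiv σ P ≤ pequiv σ Q ↔ P ≤ Q := by
  refine ⟨fun h => ?_, pmap_mono σ⟩
  have := pmap_mono σ.symm h
  simpa [pequiv, pmap_symm] using this

theorem exists_perm {I : Type*} [Fintype I] [DecidableEq I]
    (α β : Finpartition (Finset.univ : Finset I))
    (h : α.parts.val.map Finset.card = β.parts.val.map Finset.card) :
    ∃ σ : I ≃ I, pequiv σ α = β := by
  classical
  have h1 : ∀ k : ℕ, Nonempty ({a : α.parts // a.1.card = k} ≃ {b : β.parts // b.1.card = k}) := by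
    intro k
    have key : ∀ γ : Finpartition (Finset.univ : Finset I),
        Fintype.card {a : γ.parts // a.1.card = k} = (γ.parts.val.map Finset.card).count k := by
      intro γ
      rw [Multiset.count_map, Fintype.card_subtype, Finset.univ_eq_attach,
        Finset.filter_attach (fun a : Finset I => a.card = k), Finset.card_map, Finset.card_attach]
      simp only [eq_comm (a := k)]
      rfl
    exact ⟨Fintype.equivOfCardEq (by rw [key, key, h])⟩
  let e : α.parts ≃ β.parts := Equiv.ofFiberEquiv (fun k => (h1 k).some)
  have he : ∀ a, (e a).1.card = a.1.card := fun a =>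
    Equiv.ofFiberEquiv_map (f := fun a : α.parts => a.1.card) (g := fun b : β.parts => b.1.card)
      (fun k => (h1 k).some) a
  have h2 : ∀ B : β.parts, Nonempty
      ({x : I // e ⟨α.part x, by simp⟩ = B} ≃ {y : I // (⟨β.part y, by simp⟩ : β.parts) = B}) := by
    intro B
    refine ⟨Fintype.equivOfCardEq ?_⟩
    obtain ⟨A, rfl⟩ := e.surjective B
    have hl : ∀ x, e ⟨α.part x, by simp⟩ = e A ↔ x ∈ A.1 := by
      intro x
      rw [e.apply_eq_iff_eq, Subtype.ext_iff, α.part_eq_iff_mem A.2]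
    have hr : ∀ x, (⟨β.part x, by simp⟩ : β.parts) = e A ↔ x ∈ (e A).1 := by
      intro x
      rw [Subtype.ext_iff, β.part_eq_iff_mem (e A).2]
    rw [Fintype.card_of_subtype A.1 (fun x => (hl x).symm),
      Fintype.card_of_subtype (e A).1 (fun x => (hr x).symm), he]
  let σ : I ≃ I := Equiv.ofFiberEquiv (fun k => (h2 k).some)
  have hσ : ∀ x, (⟨β.part (σ x), by simp⟩ : β.parts) = e ⟨α.part x, by simp⟩ :=
    fun x => Equiv.ofFiberEquiv_map (f := fun x : I => e ⟨α.part x, by simp⟩)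
      (g := fun y : I => (⟨β.part y, by simp⟩ : β.parts)) (fun k => (h2 k).some) x
  have him : ∀ A : α.parts, A.1.map σ.toEmbedding = (e A).1 := by
    intro A
    ext y
    obtain ⟨x, rfl⟩ := σ.surjective y
    have := hσ x
    rw [← β.part_eq_iff_mem (e A).2]
    have h3 : β.part (σ x) = (e ⟨α.part x, by simp⟩).1 := congrArg Subtype.val this
    rw [h3, ← Subtype.ext_iff, e.apply_eq_iff_eq, Subtype.ext_iff, α.part_eq_iff_mem A.2]
    simp
  refine ⟨σ, ?_⟩
  ext B
  change B ∈ (pmap σ α).parts ↔ _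
  rw [mem_pmap]
  constructor
  · rintro ⟨A, hA, rfl⟩
    rw [him ⟨A, hA⟩]
    exact (e ⟨A, hA⟩).2
  · intro hB
    refine ⟨(e.symm ⟨B, hB⟩).1, (e.symm ⟨B, hB⟩).2, ?_⟩
    rw [him, e.apply_symm_apply]

theorem mu_inv {P : Type*} [PartialOrder P] [Fintype P] [DecidableEq P]
    [DecidableRel (· ≤ · : P → P → Prop)]
    (μ : P → P → ℝ) (hdiag : ∀ α, μ α α = 1)
    (hrec : ∀ α β, α < β →
      μ α β = -∑ γ ∈ Finset.univ.filter (fun γ => α ≤ γ ∧ γ ≤ β ∧ γ ≠ β), μ α γ)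
    (e : P ≃ P) (he : ∀ a b, e a ≤ e b ↔ a ≤ b) (α β : P) (h : α ≤ β) :
    μ (e α) (e β) = μ α β := by
  induction β using (Finite.wellFounded_of_trans_of_irrefl (α := P) (· < ·)).induction with
  | _ β ih =>
    rcases h.eq_or_lt with rfl | hlt
    · rw [hdiag, hdiag]
    · have hlt' : e α < e β := lt_of_le_of_ne ((he _ _).2 h) (fun hh => hlt.ne (e.injective hh))
      rw [hrec _ _ hlt, hrec _ _ hlt']
      congr 1
      symm
      refine Finset.sum_equiv e ?_ ?_
      · intro i
        simp [he]
      · intro i hi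
        simp only [Finset.mem_filter, Finset.mem_univ, true_and] at hi
        exact (ih i (lt_of_le_of_ne hi.2.1 hi.2.2) hi.1).symm

end PSC

/-- Compatibility of the zeta and Möbius matrices of the partition lattice with
the skeleton equivalence: if two partitions `α, β` of a finite set `I` have the
same multiset of block sizes, then for every partition `δ` the number of `γ` with
the same skeleton as `δ` and `α ⪯ γ` (resp. `γ ⪯ α`) coincides with the
corresponding count for `β`, and likewise the sums of the Möbius function
`μ(γ,α)` over `γ ⪯ α` with skeleton `⟨δ⟩` and `μ(α,γ)` over `γ ⪰ α` with skeleton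
`⟨δ⟩` are unchanged when `α` is replaced by `β`. -/
theorem partition_skeleton_compatibility {I : Type*} [Fintype I] [DecidableEq I]
    [DecidableRel (· ≤ · : Finpartition (Finset.univ : Finset I) →
      Finpartition (Finset.univ : Finset I) → Prop)]
    (μ : Finpartition (Finset.univ : Finset I) →
      Finpartition (Finset.univ : Finset I) → ℝ)
    (hdiag : ∀ α, μ α α = 1)
    (hrec : ∀ α β, α < β →
      μ α β = -∑ γ ∈ Finset.univ.filter (fun γ => α ≤ γ ∧ γ ≤ β ∧ γ ≠ β), μ α γ) :
    ∀ α β δ : Finpartition (Finset.univ : Finset I),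
      α.parts.val.map Finset.card = β.parts.val.map Finset.card →
      ((Finset.univ.filter (fun γ : Finpartition (Finset.univ : Finset I) =>
          γ.parts.val.map Finset.card = δ.parts.val.map Finset.card ∧ α ≤ γ)).card =
        (Finset.univ.filter (fun γ : Finpartition (Finset.univ : Finset I) =>
          γ.parts.val.map Finset.card = δ.parts.val.map Finset.card ∧ β ≤ γ)).card) ∧
      (∑ γ ∈ Finset.univ.filter (fun γ : Finpartition (Finset.univ : Finset I) =>
          γ.parts.val.map Finset.card = δ.parts.val.map Finset.card ∧ γ ≤ α), μ γ α =
        ∑ γ ∈ Finset.univ.filter (fun γ : Finpartition (Finset.univ : Finset I) =>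
          γ.parts.val.map Finset.card = δ.parts.val.map Finset.card ∧ γ ≤ β), μ γ β) ∧
      ((Finset.univ.filter (fun γ : Finpartition (Finset.univ : Finset I) =>
          γ.parts.val.map Finset.card = δ.parts.val.map Finset.card ∧ γ ≤ α)).card =
        (Finset.univ.filter (fun γ : Finpartition (Finset.univ : Finset I) =>
          γ.parts.val.map Finset.card = δ.parts.val.map Finset.card ∧ γ ≤ β)).card) ∧
      (∑ γ ∈ Finset.univ.filter (fun γ : Finpartition (Finset.univ : Finset I) =>
          γ.parts.val.map Finset.card = δ.parts.val.map Finset.card ∧ α ≤ γ), μ α γ =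
        ∑ γ ∈ Finset.univ.filter (fun γ : Finpartition (Finset.univ : Finset I) =>
          γ.parts.val.map Finset.card = δ.parts.val.map Finset.card ∧ β ≤ γ), μ β γ) := by
  intro α β δ h
  obtain ⟨σ, rfl⟩ := PSC.exists_perm α β h
  have hs : ∀ γ : Finpartition (Finset.univ : Finset I),
      (PSC.pequiv σ γ).parts.val.map Finset.card = γ.parts.val.map Finset.card :=
    PSC.skel_pmap σ
  have hle := PSC.pequiv_le σ
  have hmu := PSC.mu_inv μ hdiag (fun a b hab => by convert hrec a b hab) (PSC.pequiv σ) hle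
  refine ⟨?_, ?_, ?_, ?_⟩
  · refine Finset.card_equiv (PSC.pequiv σ) fun γ => ?_
    simp only [Finset.mem_filter, Finset.mem_univ, true_and, hs, hle]
  · refine Finset.sum_equiv (PSC.pequiv σ) (fun γ => ?_) (fun γ hγ => ?_)
    · simp only [Finset.mem_filter, Finset.mem_univ, true_and, hs, hle]
    · exact (hmu _ _ (Finset.mem_filter.1 hγ).2.2).symm
  · refine Finset.card_equiv (PSC.pequiv σ) fun γ => ?_
    simp only [Finset.mem_filter, Finset.mem_univ, true_and, hs, hle]
  · refine Finset.sum_equiv (PSC.pequiv σ) (fun γ => ?_) (fun γ hγ => ?_)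
    · simp only [Finset.mem_filter, Finset.mem_univ, true_and, hs, hle]
    · exact (hmu _ _ (Finset.mem_filter.1 hγ).2.2).symm
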